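/- Let π be a strong-Baxter permutation of size n. Then π(n) is an active site of π, i.e. π^{*π(n)} is again a strong-Baxter permutation; equivalently, writing the active sites of π as {s_{−x} < … < s_0} ∪ {s_1 < … < s_{y+1}}, where the first set consists of the active sites ≤ π(n) and the second of those > π(n), one has π(n) = s_0. -/

import Mathlib

attribute [local instance] Classical.propDecidable

noncomputable section

/-- `appendVal l m` is the permutation `σ^{*m}`: append a new final value `m`
and shift up by one all values `≥ m`. Permutations of size `n` are encoded as the
list of values `[σ(1),…,σ(n)]`. -/
def appendVal (l : List ℕ) (m : ℕ) : List ℕ :=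
  (l.map fun v => if m ≤ v then v + 1 else v) ++ [m]

/-- Avoidance of the vincular patterns 2-41-3, 3-14-2 and 3-41-2 (indices 0-based). -/
def IsStrongBaxter (l : List ℕ) : Prop :=
  ¬ ∃ i j k : ℕ, i < j ∧ j + 1 < k ∧ k < l.length ∧
    ((l.getD (j+1) 0 < l.getD i 0 ∧ l.getD i 0 < l.getD k 0 ∧ l.getD k 0 < l.getD j 0) ∨
     (l.getD j 0 < l.getD k 0 ∧ l.getD k 0 < l.getD i 0 ∧ l.getD i 0 < l.getD (j+1) 0) ∨
     (l.getD (j+1) 0 < l.getD k 0 ∧ l.getD k 0 < l.getD i 0 ∧ l.getD i 0 < l.getD j 0))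

/-- The active sites of `l`: those `m ∈ [1, n+1]` with `σ^{*m}` strong-Baxter. -/
def activeSites (l : List ℕ) : Finset ℕ :=
  (Finset.Icc 1 (l.length + 1)).filter fun m => IsStrongBaxter (appendVal l m)

/-- The last value `σ(n)` of the permutation. -/
def lastVal (l : List ℕ) : ℕ := l.getLast?.getD 0

/-- The active sites `≤ σ(n)`, in increasing order (`s_{-x} < … < s_0`). -/
def belowSites (l : List ℕ) : List ℕ :=
  ((activeSites l).filter fun m => m ≤ lastVal l).sort (· ≤ ·)

theorem appendVal_strongBaxter (l : List ℕ) (h0 : 0 < l.length) (hnd : l.Nodup)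
    (hsb : IsStrongBaxter l) : IsStrongBaxter (appendVal l (lastVal l)) := by
  have hp : lastVal l = l.getD (l.length - 1) 0 := by
    simp [lastVal, List.getLast?_eq_getElem?, List.getD]
  have hlt : ∀ t, t < l.length → (appendVal l (lastVal l)).getD t 0 =
      if lastVal l ≤ l.getD t 0 then l.getD t 0 + 1 else l.getD t 0 := by
    intro t ht
    simp [appendVal, List.getD, List.getElem?_append, ht]
  have hlast : (appendVal l (lastVal l)).getD l.length 0 = lastVal l := by
    simp [appendVal, List.getD]
  have hlen : (appendVal l (lastVal l)).length = l.length + 1 := by simp [appendVal]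
  have hne : ∀ t, t < l.length - 1 → l.getD t 0 ≠ lastVal l := by
    intro t ht h
    rw [hp, List.getD_eq_getElem _ _ (by omega), List.getD_eq_getElem _ _ (by omega)] at h
    have := (hnd.getElem_inj_iff).1 h
    omega
  rintro ⟨i, j, k, hij, hjk, hk, h⟩
  rw [hlen] at hk
  rw [hlt i (by omega), hlt j (by omega), hlt (j+1) (by omega)] at h
  by_cases hkn : k < l.length
  · rw [hlt k hkn] at h
    exact hsb ⟨i, j, k, hij, hjk, hkn, by split_ifs at h <;> omega⟩
  · obtain rfl : k = l.length := by omega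
    rw [hlast] at h
    have hi := hne i (by omega)
    have hj := hne j (by omega)
    by_cases hj1 : j + 1 = l.length - 1
    · rw [hj1, ← hp] at h
      split_ifs at h <;> omega
    · have hj' := hne (j+1) (by omega)
      refine hsb ⟨i, j, l.length - 1, hij, by omega, by omega, ?_⟩
      rw [← hp]
      split_ifs at h <;> omega

/-- for a strong-Baxter permutation `π` of size `n ≥ 1`, the value
`π(n)` is an active site, i.e. `π^{*π(n)}` is strong-Baxter; equivalently, `π(n)` is
the largest active site `≤ π(n)`, that is `π(n) = s_0`. -/
theorem strong_baxter_last_value_active (n : ℕ) (hn : 1 ≤ n) (l : List ℕ)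
    (hlen : l.length = n) (hperm : l.Perm (List.range' 1 n)) (hsb : IsStrongBaxter l) :
    IsStrongBaxter (appendVal l (lastVal l)) ∧
      (belowSites l).getLast?.getD 0 = lastVal l := by
  have h1 := appendVal_strongBaxter l (by omega) (hperm.nodup_iff.2 List.nodup_range') hsb
  refine ⟨h1, ?_⟩
  have hne : l ≠ [] := by rintro rfl; simp at hlen; omega
  have hmem : lastVal l ∈ l := by
    simp [lastVal, List.getLast?_eq_some_getLast hne]
  have hr := hperm.mem_iff.1 hmem
  rw [List.mem_range'_1] at hr
  have hb : lastVal l ∈ belowSites l := by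
    simp only [belowSites, activeSites, Finset.mem_sort, Finset.mem_filter, Finset.mem_Icc]
    exact ⟨⟨⟨by omega, by omega⟩, h1⟩, le_refl _⟩
  have hle : ∀ x ∈ belowSites l, x ≤ lastVal l := by
    intro x hx
    simp only [belowSites, Finset.mem_sort, Finset.mem_filter] at hx
    exact hx.2
  have hs : (belowSites l).Pairwise (· ≤ ·) := Finset.pairwise_sort _ _
  have hbn : belowSites l ≠ [] := List.ne_nil_of_mem hb
  rw [List.getLast?_eq_some_getLast hbn, Option.getD_some]
  exact le_antisymm (hle _ (List.getLast_mem hbn)) (hs.rel_getLast hb)
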